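/- Let d = 2. For every z ∈ ℂ ∖ [0,8] and every (m,l) ∈ ℕ₀² one has 𝒫(m,l) = ((z−4)/4)·m·l·₄F₃(1+m, 1−m, 1+l, 1−l; 1, 3/2, 3/2; (z−4)²/16) + 𝒫₀(0)·₄F₃(m, −m, l, −l; 1, 1/2, 1/2; (z−4)²/16) + Σ_{μ=1}^{m} [𝒫₀(μ) − 𝒫₀(μ−1)]·₄F₃(1+m−μ, μ−m, l, −l; 1, 1/2, 1/2; (z−4)²/16) + Σ_{ν=1}^{l} [𝒫₀(ν) − 𝒫₀(ν−1)]·₄F₃(m, −m, 1+l−ν, ν−l; 1, 1/2, 1/2; (z−4)²/16). -/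

import Mathlib

open MeasureTheory

/-- The lattice resolvent kernel `G(z,n)` in dimension `d`. -/
noncomputable def G (d : ℕ) (z : ℂ) (n : Fin d → ℤ) : ℂ :=
  (2 * (Real.pi : ℂ)) ^ (-(d : ℤ)) *
    ∫ θ : Fin d → ℝ in Set.univ.pi fun _ => Set.Icc (-Real.pi) Real.pi,
      Complex.exp (Complex.I * ∑ j, (n j : ℂ) * (θ j : ℂ)) /
        (2 * d - 2 * ∑ j, (Real.cos (θ j) : ℂ) - z)

/-- The Pochhammer symbol `(q)_k = q (q+1) ⋯ (q+k-1)` on `ℂ`. -/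
noncomputable def poch (q : ℂ) (k : ℕ) : ℂ := ∏ j ∈ Finset.range k, (q + j)

/-- The generalized hypergeometric series `₄F₃(a₁,a₂,a₃,a₄; b₁,b₂,b₃; x)`. -/
noncomputable def F43 (a₁ a₂ a₃ a₄ b₁ b₂ b₃ x : ℂ) : ℂ :=
  ∑' k : ℕ, poch a₁ k * poch a₂ k * poch a₃ k * poch a₄ k /
    (poch b₁ k * poch b₂ k * poch b₃ k * (k.factorial : ℂ)) * x ^ k

/-- `𝒫(m,l) = (-1)^{m+l} G(z, m+l, m-l)`. -/
noncomputable def P (z : ℂ) (m l : ℤ) : ℂ := (-1 : ℂ) ^ (m + l) * G 2 z ![m + l, m - l]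

/-- `𝒫₀(m) = (-1)^m G(z, m, m)`. -/
noncomputable def P₀ (z : ℂ) (m : ℤ) : ℂ := (-1 : ℂ) ^ m * G 2 z ![m, m]

/-- The second difference at `n` of the even extension to `ℤ` of a sequence on `ℕ`. -/
def evenSecondDiff (u : ℕ → ℂ) : ℕ → ℂ
  | 0 => 2 * (u 1 - u 0)
  | n + 1 => u (n + 2) - 2 * u (n + 1) + u n

theorem evenSecondDiff_zero (u : ℕ → ℂ) : evenSecondDiff u 0 = 2 * (u 1 - u 0) := rfl

theorem evenSecondDiff_succ (u : ℕ → ℂ) (n : ℕ) :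
    evenSecondDiff u (n + 1) = u (n + 2) - 2 * u (n + 1) + u n := rfl

theorem evenSecondDiff_of_even (u : ℤ → ℂ) (hu : ∀ n, u (-n) = u n) (n : ℕ) :
    evenSecondDiff (fun k : ℕ => u k) n = u (n + 1) - 2 * u n + u (n - 1) := by
  cases n with
  | zero =>
    have := hu 1
    simp only [evenSecondDiff, Nat.cast_zero, Nat.cast_one, zero_add, zero_sub, this]
    ring
  | succ n =>
    simp only [evenSecondDiff]
    push_cast
    ring_nf

theorem evenSecondDiff_sub (u v : ℕ → ℂ) (n : ℕ) :
    evenSecondDiff (fun k => u k - v k) n = evenSecondDiff u n - evenSecondDiff v n := by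
  cases n <;> simp only [evenSecondDiff] <;> ring

theorem evenSecondDiff_sum_mul {ι : Type*} (s : Finset ι) (w : ι → ℂ) (u : ι → ℕ → ℂ) (n : ℕ) :
    evenSecondDiff (fun k => ∑ i ∈ s, w i * u i k) n = ∑ i ∈ s, w i * evenSecondDiff (u i) n := by
  cases n <;>
    simp only [evenSecondDiff, Finset.mul_sum, ← Finset.sum_sub_distrib,
      ← Finset.sum_add_distrib] <;>
    exact Finset.sum_congr rfl fun i _ => by ring

theorem eq_zero_of_evenSecondDiff_eq_zero (u : ℕ → ℂ) (h0 : u 0 = 0)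
    (h : ∀ n, evenSecondDiff u n = 0) (n : ℕ) : u n = 0 := by
  induction n using Nat.strong_induction_on with
  | _ n ih =>
    match n with
    | 0 => exact h0
    | 1 => simpa [evenSecondDiff, h0] using h 0
    | n + 2 => simpa [evenSecondDiff, ih (n + 1) (by omega), ih n (by omega)] using h (n + 1)

/-- The product of the even second differences in both variables. -/
def evenSecondDiff₂ (W : ℕ → ℕ → ℂ) (m l : ℕ) : ℂ :=
  evenSecondDiff (fun k => evenSecondDiff (W k) l) m

theorem evenSecondDiff₂_sub (V W : ℕ → ℕ → ℂ) (m l : ℕ) :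
    evenSecondDiff₂ (fun i j => V i j - W i j) m l =
      evenSecondDiff₂ V m l - evenSecondDiff₂ W m l := by
  simp only [evenSecondDiff₂, evenSecondDiff_sub]

theorem evenSecondDiff₂_sum_mul {ι : Type*} (s : Finset ι) (w : ι → ℂ) (u v : ι → ℕ → ℂ)
    (m l : ℕ) :
    evenSecondDiff₂ (fun i j => ∑ k ∈ s, w k * (u k i * v k j)) m l =
      ∑ k ∈ s, w k * (evenSecondDiff (u k) m * evenSecondDiff (v k) l) := by
  have (i : ℕ) : evenSecondDiff (fun j => ∑ k ∈ s, w k * (u k i * v k j)) l =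
      ∑ k ∈ s, w k * evenSecondDiff (v k) l * u k i := by
    simp only [← mul_assoc, evenSecondDiff_sum_mul]
    exact Finset.sum_congr rfl fun _ _ => by ring
  simp only [evenSecondDiff₂, this, evenSecondDiff_sum_mul]
  exact Finset.sum_congr rfl fun _ _ => by ring

theorem evenSecondDiff₂_congr (V W : ℕ → ℕ → ℂ) (m l : ℕ)
    (h : ∀ i ≤ m + 1, ∀ j, V i j = W i j) :
    evenSecondDiff₂ V m l = evenSecondDiff₂ W m l := by
  have hrow (i : ℕ) (hi : i ≤ m + 1) : V i = W i := funext (h i hi)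
  cases m with
  | zero => simp only [evenSecondDiff₂, evenSecondDiff, hrow 0 (by omega), hrow 1 (by omega)]
  | succ m =>
    simp only [evenSecondDiff₂, evenSecondDiff, hrow m (by omega), hrow (m + 1) (by omega),
      hrow (m + 2) (by omega)]

/-- Uniqueness for the discrete Goursat problem in the quadrant. -/
theorem eq_zero_of_evenSecondDiff₂ (c : ℂ) (W : ℕ → ℕ → ℂ) (hm : ∀ m, W m 0 = 0)
    (hl : ∀ l, W 0 l = 0) (h : ∀ m l, evenSecondDiff₂ W m l = c * W m l) (m l : ℕ) :
    W m l = 0 := by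
  have hzero (k : ℕ) : evenSecondDiff (fun _ => (0 : ℂ)) k = 0 := by
    cases k <;> simp [evenSecondDiff]
  suffices ∀ m, W m = fun _ => 0 from congrFun (this m) l
  intro m
  induction m using Nat.strong_induction_on with
  | _ m ih =>
    match m with
    | 0 => exact funext hl
    | 1 =>
      refine funext (eq_zero_of_evenSecondDiff_eq_zero _ (hm 1) fun l => ?_)
      simpa [evenSecondDiff₂, evenSecondDiff_zero (fun k => evenSecondDiff (W k) l), ih 0 (by omega),
        hzero] using h 0 l
    | m + 2 =>
      refine funext (eq_zero_of_evenSecondDiff_eq_zero _ (hm _) fun l => ?_)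
      simpa [evenSecondDiff₂, evenSecondDiff_succ (fun k => evenSecondDiff (W k) l), ih m (by omega),
        ih (m + 1) (by omega), hzero] using h (m + 1) l

/-- `C(m + k, 2k + 1)`, the odd central factorial polynomial divided by `(2k + 1)!`. -/
def oddCentral (k m : ℕ) : ℂ := ((m + k).choose (2 * k + 1) : ℂ)

/-- `C(m + k, 2k)`, the kernel propagating increments of boundary data. -/
def stepCentral (k m : ℕ) : ℂ := ((m + k).choose (2 * k) : ℂ)

/-- The even central factorial polynomial `m² (m² - 1) ⋯ (m² - (k - 1)²)` divided by `(2k)!`. -/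
noncomputable def evenCentral (k m : ℕ) : ℂ :=
  (((m + k).choose (2 * k) : ℂ) + ((m + k - 1).choose (2 * k) : ℂ)) / 2

/-- The `k`-fold inverse even second difference of the sequence `a`. -/
noncomputable def iteratedSum (a : ℕ → ℂ) (k m : ℕ) : ℂ :=
  a 0 * evenCentral k m + ∑ i ∈ Finset.range m, (a (i + 1) - a i) * stepCentral k (m - 1 - i)

theorem choose_secondDiff (n r : ℕ) :
    ((n + 2).choose (r + 2) : ℂ) - 2 * ((n + 1).choose (r + 2) : ℂ) + (n.choose (r + 2) : ℂ) =
      (n.choose r : ℂ) := by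
  rw [Nat.choose_succ_succ' (n + 1), Nat.choose_succ_succ' n, Nat.choose_succ_succ' n (r + 1)]
  push_cast
  ring

theorem cast_choose_eq_zero_of_lt {a b : ℕ} (h : a < b) : ((a.choose b : ℕ) : ℂ) = 0 := by
  rw [Nat.choose_eq_zero_of_lt h, Nat.cast_zero]

theorem stepCentral_secondDiff (k j : ℕ) :
    stepCentral (k + 1) (j + 2) - 2 * stepCentral (k + 1) (j + 1) + stepCentral (k + 1) j =
      stepCentral k (j + 1) := by
  have := choose_secondDiff (j + k + 1) (2 * k)
  simp only [stepCentral]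
  rwa [show j + 2 + (k + 1) = j + k + 1 + 2 by ring, show j + 1 + (k + 1) = j + k + 1 + 1 by ring,
    show j + (k + 1) = j + k + 1 by ring, show j + 1 + k = j + k + 1 by ring,
    show 2 * (k + 1) = 2 * k + 2 by ring]

theorem oddCentral_secondDiff (k m : ℕ) :
    oddCentral (k + 1) (m + 2) - 2 * oddCentral (k + 1) (m + 1) + oddCentral (k + 1) m =
      oddCentral k (m + 1) := by
  have := choose_secondDiff (m + k + 1) (2 * k + 1)
  simp only [oddCentral]
  rwa [show m + 2 + (k + 1) = m + k + 1 + 2 by ring, show m + 1 + (k + 1) = m + k + 1 + 1 by ring,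
    show m + (k + 1) = m + k + 1 by ring, show m + 1 + k = m + k + 1 by ring,
    show 2 * (k + 1) + 1 = 2 * k + 1 + 2 by ring]

theorem stepCentral_eq_zero {k m : ℕ} (h : m < k) : stepCentral k m = 0 :=
  cast_choose_eq_zero_of_lt (by omega)

theorem oddCentral_eq_zero {k m : ℕ} (h : m ≤ k) : oddCentral k m = 0 :=
  cast_choose_eq_zero_of_lt (by omega)

theorem evenCentral_eq_zero {k m : ℕ} (h : m < k) : evenCentral k m = 0 := by
  simp only [evenCentral]
  rw [cast_choose_eq_zero_of_lt (by omega), cast_choose_eq_zero_of_lt (by omega)]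
  simp

theorem iteratedSum_eq_zero (a : ℕ → ℂ) {k m : ℕ} (h : m < k) : iteratedSum a k m = 0 := by
  rw [iteratedSum, evenCentral_eq_zero h, mul_zero, zero_add]
  refine Finset.sum_eq_zero fun i _ => ?_
  rw [stepCentral_eq_zero (by omega), mul_zero]

theorem evenCentral_zero_left (m : ℕ) : evenCentral 0 m = 1 := by simp [evenCentral]

theorem stepCentral_zero_left (m : ℕ) : stepCentral 0 m = 1 := by simp [stepCentral]

theorem evenCentral_succ (k m : ℕ) :
    evenCentral k (m + 1) = (stepCentral k (m + 1) + stepCentral k m) / 2 := by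
  simp only [evenCentral, stepCentral]
  congr 4
  omega

theorem evenSecondDiff_evenCentral (k m : ℕ) :
    evenSecondDiff (evenCentral (k + 1)) m = evenCentral k m := by
  match m with
  | 0 =>
    simp only [evenSecondDiff]
    rw [evenCentral_eq_zero (by omega : 0 < k + 1), evenCentral_succ (k + 1) 0,
      stepCentral_eq_zero (by omega : 0 < k + 1), zero_add]
    rcases k with _ | k
    · simp [evenCentral_zero_left, stepCentral]
    · rw [stepCentral_eq_zero (by omega), evenCentral_eq_zero (by omega)]
      simp
  | 1 =>
    simp only [evenSecondDiff]
    rw [evenCentral_eq_zero (by omega : 0 < k + 1)]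
    simp only [evenCentral_succ]
    have := stepCentral_secondDiff k 0
    rcases k with _ | k
    · simp [stepCentral]; norm_num
    · rw [stepCentral_eq_zero (by omega : 0 < k + 1)]
      rw [stepCentral_eq_zero (by omega : 0 < k + 1 + 1)] at this ⊢
      simp only [zero_add] at this ⊢
      rw [stepCentral_eq_zero (by omega : 1 < k + 1 + 1)] at this ⊢
      linear_combination this / 2
  | m + 2 =>
    simp only [evenSecondDiff, evenCentral_succ]
    linear_combination (stepCentral_secondDiff k m + stepCentral_secondDiff k (m + 1)) / 2

theorem evenSecondDiff_evenCentral_zero (m : ℕ) : evenSecondDiff (evenCentral 0) m = 0 := by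
  cases m <;> simp only [evenSecondDiff, evenCentral_zero_left] <;> ring

theorem evenSecondDiff_oddCentral (k m : ℕ) :
    evenSecondDiff (oddCentral (k + 1)) m = oddCentral k m := by
  cases m with
  | zero =>
    simp only [evenSecondDiff]
    rw [oddCentral_eq_zero (by omega), oddCentral_eq_zero (by omega), oddCentral_eq_zero (by omega)]
    simp
  | succ m => exact oddCentral_secondDiff k m

theorem evenSecondDiff_oddCentral_zero (m : ℕ) :
    evenSecondDiff (oddCentral 0) m = if m = 0 then 2 else 0 := by
  cases m with
  | zero => simp [evenSecondDiff, oddCentral]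
  | succ m => simp [evenSecondDiff, oddCentral]; ring

theorem iteratedSum_zero_left (a : ℕ → ℂ) (m : ℕ) : iteratedSum a 0 m = a m := by
  simp only [iteratedSum, evenCentral_zero_left, stepCentral_zero_left, mul_one,
    Finset.sum_range_sub]
  ring

theorem evenSecondDiff_iteratedSum (a : ℕ → ℂ) (k m : ℕ) :
    evenSecondDiff (iteratedSum a (k + 1)) m = iteratedSum a k m := by
  have hf := evenSecondDiff_evenCentral k m
  have h0 : stepCentral (k + 1) 0 = 0 := stepCentral_eq_zero (by omega)
  cases m with
  | zero =>
    simp only [evenSecondDiff, iteratedSum, Finset.sum_range_zero, Finset.sum_range_one] at hf ⊢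
    rw [Nat.sub_zero, Nat.sub_self, h0]
    linear_combination a 0 * hf
  | succ n =>
    have h1 : stepCentral (k + 1) 1 = stepCentral k 0 := by
      rcases k with _ | k
      · simp [stepCentral]
      · rw [stepCentral_eq_zero (by omega), stepCentral_eq_zero (by omega)]
    have hsum : ∑ i ∈ Finset.range n, (a (i + 1) - a i) * stepCentral (k + 1) (n + 1 - i)
        - 2 * ∑ i ∈ Finset.range n, (a (i + 1) - a i) * stepCentral (k + 1) (n - i)
        + ∑ i ∈ Finset.range n, (a (i + 1) - a i) * stepCentral (k + 1) (n - 1 - i) =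
        ∑ i ∈ Finset.range n, (a (i + 1) - a i) * stepCentral k (n - i) := by
      rw [Finset.mul_sum, ← Finset.sum_sub_distrib, ← Finset.sum_add_distrib]
      refine Finset.sum_congr rfl fun i hi => ?_
      obtain ⟨j, rfl⟩ : ∃ j, n = i + 1 + j := Nat.exists_eq_add_of_lt (Finset.mem_range.1 hi) |>.imp
        fun j hj => by omega
      have := stepCentral_secondDiff k j
      rw [show i + 1 + j + 1 - i = j + 2 by omega, show i + 1 + j - i = j + 1 by omega,
        show i + 1 + j - 1 - i = j by omega]
      linear_combination (a (i + 1) - a i) * this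
    simp only [evenSecondDiff, iteratedSum, Finset.sum_range_succ] at hf ⊢
    simp only [show n + 2 - 1 = n + 1 by omega, Nat.add_sub_cancel, Nat.sub_self,
      Nat.add_sub_cancel_left, h0, h1]
    linear_combination a 0 * hf + hsum

/-- The right-hand side of the closed formula, truncated to the first `N` terms of each series,
for boundary data `a` and spectral shift `c`. -/
noncomputable def truncatedSolution (c : ℂ) (a : ℕ → ℂ) (N m l : ℕ) : ℂ :=
  -c / 4 * ∑ k ∈ Finset.range N, (c ^ 2) ^ k * (oddCentral k m * oddCentral k l) +
    ∑ k ∈ Finset.range N, (c ^ 2) ^ k * (iteratedSum a k m * evenCentral k l) +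
    ∑ k ∈ Finset.range N, (c ^ 2) ^ k * (evenCentral k m * iteratedSum a k l) -
    a 0 * ∑ k ∈ Finset.range N, (c ^ 2) ^ k * (evenCentral k m * evenCentral k l)

theorem sum_range_pow_mul_of_le (x : ℂ) (u : ℕ → ℂ) {M N : ℕ} (hMN : M ≤ N)
    (hu : ∀ k, M ≤ k → u k = 0) :
    ∑ k ∈ Finset.range N, x ^ k * u k = ∑ k ∈ Finset.range M, x ^ k * u k := by
  symm
  refine Finset.sum_subset (Finset.range_mono hMN) fun k _ hk => ?_
  rw [hu k (by simpa using hk), mul_zero]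

theorem truncatedSolution_of_le (c : ℂ) (a : ℕ → ℂ) {M N m : ℕ} (l : ℕ) (hm : m < M)
    (hMN : M ≤ N) : truncatedSolution c a N m l = truncatedSolution c a M m l := by
  simp only [truncatedSolution]
  congr 1
  · congr 1
    · congr 1
      · congr 1
        exact sum_range_pow_mul_of_le _ _ hMN fun k hk => by
          rw [oddCentral_eq_zero (by omega), zero_mul]
      · exact sum_range_pow_mul_of_le _ _ hMN fun k hk => by
          rw [iteratedSum_eq_zero _ (by omega), zero_mul]
    · exact sum_range_pow_mul_of_le _ _ hMN fun k hk => by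
        rw [evenCentral_eq_zero (by omega), zero_mul]
  · congr 1
    exact sum_range_pow_mul_of_le _ _ hMN fun k hk => by
      rw [evenCentral_eq_zero (by omega), zero_mul]

theorem evenSecondDiff₂_truncatedSolution (c : ℂ) (a : ℕ → ℂ) (N m l : ℕ) :
    evenSecondDiff₂ (truncatedSolution c a (N + 1)) m l =
      c ^ 2 * truncatedSolution c a N m l - if m = 0 ∧ l = 0 then c else 0 := by
  have hadd (V W : ℕ → ℕ → ℂ) : evenSecondDiff₂ (fun i j => V i j + W i j) m l =
      evenSecondDiff₂ V m l + evenSecondDiff₂ W m l := by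
    cases m <;> cases l <;> simp only [evenSecondDiff₂, evenSecondDiff] <;> ring
  have hmul (b : ℂ) (W : ℕ → ℕ → ℂ) : evenSecondDiff₂ (fun i j => b * W i j) m l =
      b * evenSecondDiff₂ W m l := by
    cases m <;> cases l <;> simp only [evenSecondDiff₂, evenSecondDiff] <;> ring
  have hprod (u v : ℕ → ℂ) : evenSecondDiff₂ (fun i j => u i * v j) m l =
      evenSecondDiff u m * evenSecondDiff v l := by
    cases m <;> cases l <;> simp only [evenSecondDiff₂, evenSecondDiff] <;> ring
  have hodd : (if m = 0 then (2 : ℂ) else 0) * (if l = 0 then 2 else 0) =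
      if m = 0 ∧ l = 0 then 4 else 0 := by
    split_ifs <;> simp_all; norm_num
  have hfun : truncatedSolution c a (N + 1) = fun i j => truncatedSolution c a (N + 1) i j := rfl
  rw [hfun]
  simp only [truncatedSolution, evenSecondDiff₂_sub, hadd, hmul, hprod, evenSecondDiff₂_sum_mul,
    Finset.sum_range_succ', evenSecondDiff_oddCentral, evenSecondDiff_evenCentral,
    evenSecondDiff_iteratedSum, evenSecondDiff_evenCentral_zero, evenSecondDiff_oddCentral_zero,
    hodd, pow_succ _ (_ : ℕ), mul_zero, zero_mul, add_zero, pow_zero, one_mul]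
  have hshift (u : ℕ → ℂ) : ∑ k ∈ Finset.range N, (c * c) ^ k * (c * c) * u k =
      c * c * ∑ k ∈ Finset.range N, (c * c) ^ k * u k := by
    rw [Finset.mul_sum]
    exact Finset.sum_congr rfl fun _ _ => by ring
  simp only [hshift]
  split_ifs <;> ring

theorem truncatedSolution_zero_right (c : ℂ) (a : ℕ → ℂ) (N m : ℕ) :
    truncatedSolution c a (N + 1) m 0 = a m := by
  simp [truncatedSolution, Finset.sum_range_succ', oddCentral_eq_zero, evenCentral_eq_zero,
    iteratedSum_eq_zero, evenCentral_zero_left, iteratedSum_zero_left]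

theorem truncatedSolution_comm (c : ℂ) (a : ℕ → ℂ) (N m l : ℕ) :
    truncatedSolution c a N m l = truncatedSolution c a N l m := by
  simp only [truncatedSolution, mul_comm (iteratedSum a _ m), mul_comm (evenCentral _ m),
    mul_comm (oddCentral _ m)]
  ring

theorem eq_truncatedSolution (c : ℂ) (V : ℕ → ℕ → ℂ) (hsymm : ∀ l, V 0 l = V l 0)
    (hV : ∀ m l, evenSecondDiff₂ V m l = c ^ 2 * V m l - if m = 0 ∧ l = 0 then c else 0)
    (m l : ℕ) : V m l = truncatedSolution c (fun k => V k 0) (m + 1) m l := by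
  set a : ℕ → ℂ := fun k => V k 0
  refine sub_eq_zero.1 (eq_zero_of_evenSecondDiff₂ (c ^ 2)
    (fun m l => V m l - truncatedSolution c a (m + 1) m l) (fun m => ?_) (fun l => ?_)
    (fun m l => ?_) m l)
  · simp [truncatedSolution_zero_right, a]
  · rw [truncatedSolution_comm, truncatedSolution_zero_right, hsymm, sub_self]
  · rw [evenSecondDiff₂_sub, hV, evenSecondDiff₂_congr (fun i j => truncatedSolution c a (i + 1) i j)
      (truncatedSolution c a (m + 1 + 1)) m l fun i hi j =>
        (truncatedSolution_of_le c a j (Nat.lt_succ_self i) (by omega)).symm,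
      evenSecondDiff₂_truncatedSolution]
    ring

theorem poch_zero (q : ℂ) : poch q 0 = 1 := by simp [poch]

theorem poch_succ (q : ℂ) (k : ℕ) : poch q (k + 1) = poch q k * (q + k) := by
  simp [poch, Finset.prod_range_succ]

theorem poch_succ_left (q : ℂ) (k : ℕ) : poch q (k + 1) = q * poch (q + 1) k := by
  simp only [poch, Finset.prod_range_succ']
  rw [mul_comm]
  congr 1
  · simp
  · exact Finset.prod_congr rfl fun _ _ => by push_cast; ring

theorem poch_one (k : ℕ) : poch 1 k = (k.factorial : ℂ) := by
  induction k with
  | zero => simp [poch_zero]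
  | succ k ih => rw [poch_succ, ih, Nat.factorial_succ]; push_cast; ring

theorem poch_half_mul_factorial (k : ℕ) :
    poch (1 / 2) k * (k.factorial : ℂ) * 4 ^ k = ((2 * k).factorial : ℂ) := by
  induction k with
  | zero => simp [poch_zero]
  | succ k ih =>
    rw [show 2 * (k + 1) = 2 * k + 1 + 1 by ring, Nat.factorial_succ (2 * k + 1),
      Nat.factorial_succ (2 * k), poch_succ, Nat.factorial_succ k]
    push_cast
    rw [← ih]
    ring

theorem poch_three_halves_mul_factorial (k : ℕ) :
    poch (3 / 2) k * (k.factorial : ℂ) * 4 ^ k = ((2 * k + 1).factorial : ℂ) := by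
  induction k with
  | zero => simp [poch_zero]
  | succ k ih =>
    rw [show 2 * (k + 1) + 1 = 2 * k + 1 + 1 + 1 by ring, Nat.factorial_succ (2 * k + 1 + 1),
      Nat.factorial_succ (2 * k + 1), poch_succ, Nat.factorial_succ k]
    push_cast
    rw [← ih]
    ring

theorem cast_choose_succ_right (n r : ℕ) :
    (n.choose (r + 1) : ℂ) * (r + 1) = n.choose r * ((n : ℂ) - r) := by
  have h := Nat.choose_succ_right_eq n r
  rcases le_or_gt r n with hr | hr
  · rw [← Nat.cast_sub hr]
    exact_mod_cast h
  · rw [cast_choose_eq_zero_of_lt hr, cast_choose_eq_zero_of_lt (by omega : n < r + 1)]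
    simp

theorem cast_choose_succ_succ (n r : ℕ) :
    ((n + 1).choose (r + 1) : ℂ) * (r + 1) = (n + 1) * n.choose r := by
  exact_mod_cast (Nat.add_one_mul_choose_eq n r).symm

theorem cast_choose_add_one_add_two (n r : ℕ) :
    ((n + 1).choose (r + 2) : ℂ) * ((r + 1) * (r + 2)) = (n + 1) * (n - r) * n.choose r := by
  have h₁ := cast_choose_succ_succ n (r + 1)
  have h₂ := cast_choose_succ_right n r
  push_cast at h₁
  linear_combination (r + 1 : ℂ) * h₁ + (n + 1 : ℂ) * h₂

theorem poch_mul_poch_oddCentral (m k : ℕ) :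
    (m : ℂ) * (poch (1 + m) k * poch (1 - m) k) =
      (-1) ^ k * ((2 * k + 1).factorial : ℂ) * oddCentral k m := by
  induction k with
  | zero => simp [poch_zero, oddCentral]
  | succ k ih =>
    have h := cast_choose_add_one_add_two (m + k) (2 * k + 1)
    rw [oddCentral, show 2 * (k + 1) + 1 = 2 * k + 1 + 2 by ring, Nat.factorial_succ,
      Nat.factorial_succ (2 * k + 1), poch_succ, poch_succ, ← add_assoc m]
    rw [oddCentral] at ih
    push_cast at h ⊢
    linear_combination ((1 : ℂ) + m + k) * (1 - m + k) * ih +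
      (-1) ^ k * ((2 * k + 1).factorial : ℂ) * h

theorem poch_mul_poch_stepCentral (m k : ℕ) :
    poch (1 + m) k * poch (-m) k = (-1) ^ k * ((2 * k).factorial : ℂ) * stepCentral k m := by
  induction k with
  | zero => simp [poch_zero, stepCentral]
  | succ k ih =>
    have h := cast_choose_add_one_add_two (m + k) (2 * k)
    rw [stepCentral, show 2 * (k + 1) = 2 * k + 2 by ring, Nat.factorial_succ,
      Nat.factorial_succ (2 * k), poch_succ, poch_succ, ← add_assoc m]
    rw [stepCentral] at ih
    push_cast at h ⊢
    linear_combination ((1 : ℂ) + m + k) * (-m + k) * ih +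
      (-1) ^ k * ((2 * k).factorial : ℂ) * h

theorem evenCentral_succ_left (k m : ℕ) :
    evenCentral (k + 1) m * (2 * k + 2) = m * oddCentral k m := by
  have h₁ := cast_choose_succ_succ (m + k) (2 * k + 1)
  have h₂ := cast_choose_succ_right (m + k) (2 * k + 1)
  rw [evenCentral, oddCentral, ← add_assoc, Nat.add_sub_cancel,
    show 2 * (k + 1) = 2 * k + 1 + 1 by ring]
  push_cast at h₁ h₂ ⊢
  linear_combination (h₁ + h₂) / 2

theorem poch_mul_poch_evenCentral (m k : ℕ) :
    poch m k * poch (-m) k = (-1) ^ k * ((2 * k).factorial : ℂ) * evenCentral k m := by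
  cases k with
  | zero => simp [poch_zero, evenCentral_zero_left]
  | succ k =>
    have h := poch_mul_poch_oddCentral m k
    have h' := evenCentral_succ_left k m
    rw [poch_succ_left, poch_succ_left, show 2 * (k + 1) = 2 * k + 1 + 1 by ring,
      Nat.factorial_succ, add_comm (m : ℂ) 1, neg_add_eq_sub]
    push_cast
    linear_combination (-m : ℂ) * h + (-1) ^ k * ((2 * k + 1).factorial : ℂ) * h'

theorem mul_F43_eq_sum (p q a₁ a₂ a₃ a₄ b x : ℂ) (w u v : ℕ → ℂ) (N : ℕ)
    (hw : ∀ k, poch b k * (k.factorial : ℂ) * 4 ^ k = w k) (hw0 : ∀ k, w k ≠ 0)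
    (hu : ∀ k, p * (poch a₁ k * poch a₂ k) = (-1) ^ k * w k * u k)
    (hv : ∀ k, q * (poch a₃ k * poch a₄ k) = (-1) ^ k * w k * v k)
    (h0 : ∀ k, N ≤ k → u k * v k = 0) :
    p * q * F43 a₁ a₂ a₃ a₄ 1 b b (x / 16) = ∑ k ∈ Finset.range N, x ^ k * (u k * v k) := by
  rw [F43, ← tsum_mul_left, ← tsum_eq_sum (s := Finset.range N) (L := .unconditional ℕ)]
  · refine tsum_congr fun k => ?_
    have hb : poch b k * (k.factorial : ℂ) ≠ 0 := left_ne_zero_of_mul (hw k ▸ hw0 k)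
    have hs : ((-1 : ℂ) ^ k) ^ 2 = 1 := by rw [← pow_mul, mul_comm, pow_mul]; simp
    have h16 : (16 : ℂ) ^ k = (4 ^ k) ^ 2 := by rw [← pow_mul, mul_comm, pow_mul]; norm_num
    have h4 : (4 : ℂ) ^ k ≠ 0 := pow_ne_zero _ (by norm_num)
    have key : p * (poch a₁ k * poch a₂ k) * (q * (poch a₃ k * poch a₄ k)) =
        w k ^ 2 * (u k * v k) := by
      rw [hu, hv]
      linear_combination w k ^ 2 * u k * v k * hs
    have hden : poch 1 k * poch b k * poch b k * (k.factorial : ℂ) =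
        (poch b k * (k.factorial : ℂ)) ^ 2 := by rw [poch_one]; ring
    rw [hden, div_pow, h16]
    have hb₁ := left_ne_zero_of_mul hb
    have hb₂ := right_ne_zero_of_mul hb
    rw [← hw k] at key
    field_simp
    linear_combination x ^ k * key
  · intro k hk
    rw [h0 k (by simpa using hk), mul_zero]

theorem mul_F43_odd (x : ℂ) {m N : ℕ} (l : ℕ) (h : m < N) :
    (m : ℂ) * l * F43 (1 + m) (1 - m) (1 + l) (1 - l) 1 (3 / 2) (3 / 2) (x / 16) =
      ∑ k ∈ Finset.range N, x ^ k * (oddCentral k m * oddCentral k l) :=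
  mul_F43_eq_sum _ _ _ _ _ _ _ _ _ _ _ N poch_three_halves_mul_factorial
    (fun k => by exact_mod_cast (Nat.factorial_ne_zero _)) (poch_mul_poch_oddCentral m)
    (poch_mul_poch_oddCentral l) fun k hk => by rw [oddCentral_eq_zero (by omega), zero_mul]

theorem F43_even (x : ℂ) {m N : ℕ} (l : ℕ) (h : m < N) :
    F43 m (-m) l (-l) 1 (1 / 2) (1 / 2) (x / 16) =
      ∑ k ∈ Finset.range N, x ^ k * (evenCentral k m * evenCentral k l) := by
  simpa only [one_mul] using mul_F43_eq_sum 1 1 m (-m) l (-l) (1 / 2) x _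
    (fun k => evenCentral k m) (fun k => evenCentral k l) N poch_half_mul_factorial
    (fun k => by exact_mod_cast (Nat.factorial_ne_zero _))
    (fun k => by rw [one_mul, poch_mul_poch_evenCentral])
    (fun k => by rw [one_mul, poch_mul_poch_evenCentral])
    fun k hk => by rw [evenCentral_eq_zero (by omega), zero_mul]

theorem F43_step_left (x : ℂ) {j N : ℕ} (l : ℕ) (h : j < N) :
    F43 (1 + j) (-j) l (-l) 1 (1 / 2) (1 / 2) (x / 16) =
      ∑ k ∈ Finset.range N, x ^ k * (stepCentral k j * evenCentral k l) := by
  simpa only [one_mul] using mul_F43_eq_sum 1 1 (1 + j) (-j) l (-l) (1 / 2) x _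
    (fun k => stepCentral k j) (fun k => evenCentral k l) N poch_half_mul_factorial
    (fun k => by exact_mod_cast (Nat.factorial_ne_zero _))
    (fun k => by rw [one_mul, poch_mul_poch_stepCentral])
    (fun k => by rw [one_mul, poch_mul_poch_evenCentral])
    fun k hk => by rw [stepCentral_eq_zero (by omega), zero_mul]

theorem F43_step_right (x : ℂ) {m N : ℕ} (j : ℕ) (h : m < N) :
    F43 m (-m) (1 + j) (-j) 1 (1 / 2) (1 / 2) (x / 16) =
      ∑ k ∈ Finset.range N, x ^ k * (evenCentral k m * stepCentral k j) := by
  simpa only [one_mul] using mul_F43_eq_sum 1 1 m (-m) (1 + j) (-j) (1 / 2) x _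
    (fun k => evenCentral k m) (fun k => stepCentral k j) N poch_half_mul_factorial
    (fun k => by exact_mod_cast (Nat.factorial_ne_zero _))
    (fun k => by rw [one_mul, poch_mul_poch_evenCentral])
    (fun k => by rw [one_mul, poch_mul_poch_stepCentral])
    fun k hk => by rw [evenCentral_eq_zero (by omega), zero_mul]

theorem sum_Icc_one_cast (n : ℕ) (f : ℤ → ℂ) :
    ∑ μ ∈ Finset.Icc (1 : ℤ) n, f μ = ∑ i ∈ Finset.range n, f (i + 1) := by
  symm
  refine Finset.sum_nbij' (fun i => (i : ℤ) + 1) (fun μ => (μ - 1).toNat) ?_ ?_ ?_ ?_ ?_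
  · intro i hi
    simp only [Finset.mem_range, Finset.mem_Icc] at hi ⊢
    omega
  · intro μ hμ
    simp only [Finset.mem_range, Finset.mem_Icc] at hμ ⊢
    omega
  · intro i _
    simp
  · intro μ hμ
    simp only [Finset.mem_Icc] at hμ
    omega
  · simp

theorem sum_mul_sum_stepCentral (x : ℂ) (a v : ℕ → ℂ) (n N : ℕ) :
    ∑ i ∈ Finset.range n, (a (i + 1) - a i) *
        ∑ k ∈ Finset.range N, x ^ k * (stepCentral k (n - 1 - i) * v k) =
      ∑ k ∈ Finset.range N, x ^ k * (iteratedSum a k n * v k) -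
        a 0 * ∑ k ∈ Finset.range N, x ^ k * (evenCentral k n * v k) := by
  simp only [Finset.mul_sum]
  rw [Finset.sum_comm, ← Finset.sum_sub_distrib]
  refine Finset.sum_congr rfl fun k _ => ?_
  rw [iteratedSum, add_mul, mul_add, Finset.sum_mul, Finset.mul_sum]
  rw [add_sub_right_comm, show x ^ k * (a 0 * evenCentral k n * v k) -
    a 0 * (x ^ k * (evenCentral k n * v k)) = 0 by ring, zero_add]
  exact Finset.sum_congr rfl fun i _ => by ring

/-- The truncated solution in terms of `₄F₃`. -/
theorem truncatedSolution_eq_F43 (c x : ℂ) (hx : x = c ^ 2) (a : ℤ → ℂ) (m l : ℕ) :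
    truncatedSolution c (fun k => a k) (m + 1) m l =
      -c / 4 * m * l * F43 (1 + m) (1 - m) (1 + l) (1 - l) 1 (3 / 2) (3 / 2) (x / 16)
      + a 0 * F43 m (-m) l (-l) 1 (1 / 2) (1 / 2) (x / 16)
      + ∑ μ ∈ Finset.Icc (1 : ℤ) m, (a μ - a (μ - 1)) *
          F43 (1 + m - μ) ((μ : ℂ) - m) l (-l) 1 (1 / 2) (1 / 2) (x / 16)
      + ∑ ν ∈ Finset.Icc (1 : ℤ) l, (a ν - a (ν - 1)) *
          F43 m (-m) (1 + l - ν) ((ν : ℂ) - l) 1 (1 / 2) (1 / 2) (x / 16) := by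
  subst hx
  have hcast {n i : ℕ} (hi : i ∈ Finset.range n) : ((n - 1 - i : ℕ) : ℂ) = n - 1 - i := by
    have : n = (n - 1 - i) + 1 + i := by have := Finset.mem_range.1 hi; omega
    conv_rhs => rw [this]
    push_cast
    ring
  have hm : ∑ μ ∈ Finset.Icc (1 : ℤ) m, (a μ - a (μ - 1)) *
      F43 (1 + m - μ) ((μ : ℂ) - m) l (-l) 1 (1 / 2) (1 / 2) (c ^ 2 / 16) =
      ∑ i ∈ Finset.range m, (a ((i + 1 : ℕ) : ℤ) - a i) * ∑ k ∈ Finset.range (m + 1),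
        (c ^ 2) ^ k * (stepCentral k (m - 1 - i) * evenCentral k l) := by
    rw [sum_Icc_one_cast]
    refine Finset.sum_congr rfl fun i hi => ?_
    rw [← F43_step_left _ _ (by omega), hcast hi]
    push_cast
    rw [add_sub_cancel_right]
    congr 2 <;> ring
  have hl : ∑ ν ∈ Finset.Icc (1 : ℤ) l, (a ν - a (ν - 1)) *
      F43 m (-m) (1 + l - ν) ((ν : ℂ) - l) 1 (1 / 2) (1 / 2) (c ^ 2 / 16) =
      ∑ i ∈ Finset.range l, (a ((i + 1 : ℕ) : ℤ) - a i) * ∑ k ∈ Finset.range (m + 1),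
        (c ^ 2) ^ k * (stepCentral k (l - 1 - i) * evenCentral k m) := by
    rw [sum_Icc_one_cast]
    refine Finset.sum_congr rfl fun i hi => ?_
    simp only [mul_comm (stepCentral _ _)]
    rw [← F43_step_right _ _ (by omega), hcast hi]
    push_cast
    rw [add_sub_cancel_right]
    congr 2 <;> ring
  rw [hm, hl, sum_mul_sum_stepCentral _ (fun k => a k), sum_mul_sum_stepCentral _ (fun k => a k),
    mul_assoc (-c / 4), mul_assoc (-c / 4), mul_F43_odd _ _ (Nat.lt_succ_self m),
    F43_even _ _ (Nat.lt_succ_self m), truncatedSolution]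
  simp only [mul_comm (evenCentral _ m), Nat.cast_zero]
  ring

/-- The denominator of `G 2 z` has no zeros for `z` off the spectrum. -/
theorem symbol_ne_zero {z : ℂ} (hz : ∀ x : ℝ, 0 ≤ x → x ≤ 8 → z ≠ (x : ℂ)) (θ : Fin 2 → ℝ) :
    2 * ((2 : ℕ) : ℂ) - 2 * ∑ j, (Real.cos (θ j) : ℂ) - z ≠ 0 := by
  intro h
  refine hz (4 - 2 * (Real.cos (θ 0) + Real.cos (θ 1))) ?_ ?_ ?_
  · linarith [Real.cos_le_one (θ 0), Real.cos_le_one (θ 1)]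
  · linarith [Real.neg_one_le_cos (θ 0), Real.neg_one_le_cos (θ 1)]
  · rw [Fin.sum_univ_two] at h
    push_cast at h ⊢
    linear_combination -h

/-- The fundamental domain of the two-dimensional torus. -/
abbrev brillouin : Set (Fin 2 → ℝ) := Set.univ.pi fun _ => Set.Icc (-Real.pi) Real.pi

theorem isCompact_brillouin : IsCompact brillouin := isCompact_univ_pi fun _ => isCompact_Icc

theorem integrableOn_green {z : ℂ} (hz : ∀ x : ℝ, 0 ≤ x → x ≤ 8 → z ≠ (x : ℂ)) (n : Fin 2 → ℤ) :
    IntegrableOn (fun θ : Fin 2 → ℝ => Complex.exp (Complex.I * ∑ j, (n j : ℂ) * (θ j : ℂ)) /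
      (2 * ((2 : ℕ) : ℂ) - 2 * ∑ j, (Real.cos (θ j) : ℂ) - z)) brillouin := by
  refine ContinuousOn.integrableOn_compact isCompact_brillouin (Continuous.continuousOn ?_)
  exact Continuous.div (by fun_prop) (by fun_prop) (symbol_ne_zero hz)

theorem integral_fourier_Icc (n : ℤ) :
    ∫ θ in Set.Icc (-Real.pi) Real.pi, Complex.exp (Complex.I * (n * (θ : ℂ))) =
      if n = 0 then 2 * (Real.pi : ℂ) else 0 := by
  rw [integral_Icc_eq_integral_Ioc, ← intervalIntegral.integral_of_le (by linarith [Real.pi_pos])]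
  simp only [← mul_assoc]
  split_ifs with h
  · simp [h]; ring
  · rw [integral_exp_mul_complex (by simp [h, Complex.I_ne_zero])]
    have : Complex.I * n * ((Real.pi : ℝ) : ℂ) =
        Complex.I * n * ((-Real.pi : ℝ) : ℂ) + n * (2 * Real.pi * Complex.I) := by
      push_cast; ring
    rw [this, Complex.exp_add, Complex.exp_int_mul_two_pi_mul_I]
    simp

theorem integral_fourier_brillouin (n : Fin 2 → ℤ) :
    ∫ θ in brillouin, Complex.exp (Complex.I * ∑ j, (n j : ℂ) * (θ j : ℂ)) =
      if n = 0 then (2 * (Real.pi : ℂ)) ^ 2 else 0 := by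
  simp only [Finset.mul_sum, Complex.exp_sum]
  rw [volume_pi, Measure.restrict_pi_pi, integral_fintype_prod_eq_prod
    (f := fun i (x : ℝ) => Complex.exp (Complex.I * ((n i : ℂ) * (x : ℂ))))]
  simp only [integral_fourier_Icc, Fin.prod_univ_two, funext_iff, Fin.forall_fin_two, Pi.zero_apply]
  split_ifs <;> simp_all [sq]

theorem G_two_five_point {z : ℂ} (hz : ∀ x : ℝ, 0 ≤ x → x ≤ 8 → z ≠ (x : ℂ)) (a b : ℤ) :
    G 2 z ![a + 1, b] + G 2 z ![a - 1, b] + G 2 z ![a, b + 1] + G 2 z ![a, b - 1] =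
      (4 - z) * G 2 z ![a, b] - if a = 0 ∧ b = 0 then 1 else 0 := by
  have hδ : (2 * (Real.pi : ℂ)) ^ (-((2 : ℕ) : ℤ)) *
      ∫ θ in brillouin, Complex.exp (Complex.I * ∑ j, (![a, b] j : ℂ) * (θ j : ℂ)) =
      if a = 0 ∧ b = 0 then 1 else 0 := by
    rw [integral_fourier_brillouin]
    have : ![a, b] = 0 ↔ a = 0 ∧ b = 0 := by simp [funext_iff, Fin.forall_fin_two]
    have hpi : (Real.pi : ℂ) ≠ 0 := by exact_mod_cast Real.pi_ne_zero
    simp only [this]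
    split_ifs
    · rw [zpow_neg, zpow_natCast]
      exact inv_mul_cancel₀ (pow_ne_zero _ (mul_ne_zero two_ne_zero hpi))
    · simp
  rw [← hδ]
  simp only [G]
  rw [← mul_add, ← mul_add, ← mul_add, mul_left_comm (4 - z), ← mul_sub]
  congr 1
  have hi := integrableOn_green hz
  rw [← integral_const_mul, ← integral_add (hi _) (hi _), ← integral_add, ← integral_add,
    ← integral_sub ((hi _).const_mul _)]
  · refine integral_congr_ae (Filter.Eventually.of_forall fun θ => ?_)
    have hD := symbol_ne_zero hz θ
    simp only [Fin.sum_univ_two, Matrix.cons_val_zero, Matrix.cons_val_one] at hD ⊢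
    rw [← add_div, ← add_div, ← add_div, div_eq_iff hD, sub_mul, mul_assoc, div_mul_cancel₀ _ hD]
    have hexp (u v : ℂ) : Complex.exp (Complex.I * (u * θ 0 + v * θ 1)) =
        Complex.exp (u * θ 0 * Complex.I) * Complex.exp (v * θ 1 * Complex.I) := by
      rw [← Complex.exp_add]; ring_nf
    simp only [hexp]
    push_cast
    simp only [add_mul, sub_mul, one_mul, Complex.exp_add, Complex.exp_sub, Complex.cos,
      div_eq_mul_inv, ← Complex.exp_neg, neg_mul]
    ring
  · exact ContinuousOn.integrableOn_compact isCompact_brillouin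
      (Continuous.continuousOn (by fun_prop))
  · exact ((hi _).add (hi _)).add (hi _)
  · exact hi _
  · exact (hi _).add (hi _)
  · exact hi _

theorem G_two_swap (z : ℂ) (a b : ℤ) : G 2 z ![a, b] = G 2 z ![b, a] := by
  have hmp := volume_preserving_arrowCongr' (Equiv.swap (0 : Fin 2) 1) (MeasurableEquiv.refl ℝ)
    (MeasurePreserving.id _)
  have happ (θ : Fin 2 → ℝ) (i : Fin 2) :
      MeasurableEquiv.arrowCongr' (Equiv.swap (0 : Fin 2) 1) (MeasurableEquiv.refl ℝ) θ i =
        θ (Equiv.swap 0 1 i) := rfl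
  simp only [G]
  congr 1
  rw [← hmp.setIntegral_preimage_emb (MeasurableEquiv.measurableEmbedding _)]
  have hpre : (MeasurableEquiv.arrowCongr' (Equiv.swap (0 : Fin 2) 1) (MeasurableEquiv.refl ℝ)) ⁻¹'
      brillouin = brillouin := by
    ext θ
    simp only [Set.mem_preimage, Set.mem_univ_pi, happ, Fin.forall_fin_two, Equiv.swap_apply_left,
      Equiv.swap_apply_right, and_comm]
  rw [hpre]
  refine integral_congr_ae (Filter.Eventually.of_forall fun θ => ?_)
  simp only [Fin.sum_univ_two, happ, Equiv.swap_apply_left, Equiv.swap_apply_right,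
    Matrix.cons_val_zero, Matrix.cons_val_one, add_comm]

theorem G_two_neg_right (z : ℂ) (a b : ℤ) : G 2 z ![a, -b] = G 2 z ![a, b] := by
  let e : Fin 2 → ℝ ≃ᵐ ℝ := ![MeasurableEquiv.refl ℝ, MeasurableEquiv.neg ℝ]
  have he : ∀ i, MeasurePreserving (e i) volume volume := by
    rw [Fin.forall_fin_two]
    exact ⟨MeasurePreserving.id _, Measure.measurePreserving_neg _⟩
  have hmp := volume_preserving_pi he
  simp only [G]
  congr 1
  rw [← hmp.setIntegral_preimage_emb (MeasurableEquiv.piCongrRight e).measurableEmbedding]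
  have hpre : (fun (θ : Fin 2 → ℝ) i => e i (θ i)) ⁻¹' brillouin = brillouin := by
    ext θ
    simp only [Set.mem_preimage, Set.mem_univ_pi, Fin.forall_fin_two]
    simp [e, and_comm, neg_le]
  rw [hpre]
  refine integral_congr_ae (Filter.Eventually.of_forall fun θ => ?_)
  simp [Fin.sum_univ_two, e]

theorem P_comm (z : ℂ) (m l : ℤ) : P z m l = P z l m := by
  rw [P, P, add_comm, ← neg_sub m l, G_two_neg_right]

theorem P_neg_right (z : ℂ) (m l : ℤ) : P z m (-l) = P z m l := by
  rw [P, P, sub_neg_eq_add, ← sub_eq_add_neg, G_two_swap, show m - l = m + l + 2 * -l by ring,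
    zpow_add₀ (by norm_num), zpow_mul]
  norm_num

theorem P_neg_left (z : ℂ) (m l : ℤ) : P z (-m) l = P z m l := by
  rw [P_comm, P_neg_right, P_comm]

theorem P_zero_right (z : ℂ) (m : ℤ) : P z m 0 = P₀ z m := by
  rw [P, P₀, add_zero, sub_zero]

theorem P_secondDiff {z : ℂ} (hz : ∀ x : ℝ, 0 ≤ x → x ≤ 8 → z ≠ (x : ℂ)) (m l : ℤ) :
    (P z (m + 1) (l + 1) - 2 * P z (m + 1) l + P z (m + 1) (l - 1))
      - 2 * (P z m (l + 1) - 2 * P z m l + P z m (l - 1))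
      + (P z (m - 1) (l + 1) - 2 * P z (m - 1) l + P z (m - 1) (l - 1)) =
    (4 - z) ^ 2 * P z m l - if m = 0 ∧ l = 0 then 4 - z else 0 := by
  set a := m + l with ha
  set b := m - l with hb
  have h₀ := G_two_five_point hz a b
  have h₁ := G_two_five_point hz (a + 1) b
  have h₂ := G_two_five_point hz (a - 1) b
  have h₃ := G_two_five_point hz a (b + 1)
  have h₄ := G_two_five_point hz a (b - 1)
  rw [if_neg (by omega)] at h₁ h₂ h₃ h₄
  simp only [show a = 0 ∧ b = 0 ↔ m = 0 ∧ l = 0 by omega] at h₀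
  have hs (i j : ℤ) : P z (m + i) (l + j) =
      (-1) ^ a * ((-1) ^ (i + j) * G 2 z ![a + (i + j), b + (i - j)]) := by
    rw [P, show m + i + (l + j) = a + (i + j) by omega, show m + i - (l + j) = b + (i - j) by omega,
      zpow_add₀ (by norm_num), mul_assoc]
  have hδ : (-1 : ℂ) ^ a * (if m = 0 ∧ l = 0 then 1 else 0) = if m = 0 ∧ l = 0 then 1 else 0 := by
    split_ifs with h
    · simp [ha, h]
    · simp
  have e₁ := hs 1 1
  have e₂ := hs 1 0
  have e₃ := hs 1 (-1)
  have e₄ := hs 0 1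
  have e₅ := hs 0 0
  have e₆ := hs 0 (-1)
  have e₇ := hs (-1) 1
  have e₈ := hs (-1) 0
  have e₉ := hs (-1) (-1)
  norm_num [← sub_eq_add_neg] at e₁ e₂ e₃ e₄ e₅ e₆ e₇ e₈ e₉
  have hif : (if m = 0 ∧ l = 0 then 4 - z else 0) =
      (4 - z) * if m = 0 ∧ l = 0 then 1 else 0 := by simp
  rw [e₁, e₂, e₃, e₄, e₅, e₆, e₇, e₈, e₉, hif, ← hδ]
  simp only [add_sub_cancel_right, sub_add_cancel, add_assoc, sub_sub, one_add_one_eq_two]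
    at h₀ h₁ h₂ h₃ h₄
  linear_combination (-1 : ℂ) ^ a * (h₁ + h₂ + h₃ + h₄ + (4 - z) * h₀)

/-- Closed formula for `𝒫(m,l)` in terms of terminating `₄F₃` sums and diagonal values. -/
theorem P_eq_hypergeometric (z : ℂ) (hz : ∀ x : ℝ, 0 ≤ x → x ≤ 8 → z ≠ (x : ℂ))
    (m l : ℕ) :
    P z m l =
      (z - 4) / 4 * m * l *
        F43 (1 + m) (1 - m) (1 + l) (1 - l) 1 (3 / 2) (3 / 2) ((z - 4) ^ 2 / 16)
      + P₀ z 0 * F43 m (-m) l (-l) 1 (1 / 2) (1 / 2) ((z - 4) ^ 2 / 16)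
      + ∑ μ ∈ Finset.Icc (1 : ℤ) m, (P₀ z μ - P₀ z (μ - 1)) *
          F43 (1 + m - μ) ((μ : ℂ) - m) l (-l) 1 (1 / 2) (1 / 2) ((z - 4) ^ 2 / 16)
      + ∑ ν ∈ Finset.Icc (1 : ℤ) l, (P₀ z ν - P₀ z (ν - 1)) *
          F43 m (-m) (1 + l - ν) ((ν : ℂ) - l) 1 (1 / 2) (1 / 2) ((z - 4) ^ 2 / 16) := by
  have hV := eq_truncatedSolution (4 - z) (fun i j => P z i j)
    (fun l => by rw [P_comm]) (fun i j => ?_) m l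
  · rw [hV]
    simp only [Nat.cast_zero, P_zero_right]
    rw [truncatedSolution_eq_F43 (4 - z) ((z - 4) ^ 2) (by ring) (P₀ z), neg_sub]
  · have hrow (k : ℤ) : evenSecondDiff (fun n : ℕ => P z k n) j =
        P z k (j + 1) - 2 * P z k j + P z k (j - 1) :=
      evenSecondDiff_of_even (P z k) (P_neg_right z k) j
    simp only [evenSecondDiff₂, hrow]
    rw [evenSecondDiff_of_even (fun k => P z k (j + 1) - 2 * P z k j + P z k (j - 1))
      (fun k => by simp only [P_neg_left]), P_secondDiff hz]
    simp
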